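/- arXiv:2410.20985 — 5 statements merged into one kernel-verified Lean document; each statement's English description precedes it below -/
import Mathlib

section
/- Let ε ∈ (0,1) and let C be the convex hull in ℂ of the union of the closed ball of centre 0 and radius ε with the singleton {1}. If p is a polynomial with complex coefficients of degree k ∈ ℕ such that p(z) ≠ 0 for every z ∈ C, then |p(x)| ≥ (ε/2)^k · |p(1)| for every real x ∈ [0,1]. -/
theorem norm_one_sub_le_of_notMem_convexHull {ε : ℝ} (hε : ε ∈ Set.Ioo (0 : ℝ) 1) {a : ℂ}
    (ha : a ∉ convexHull ℝ (Metric.closedBall (0 : ℂ) ε ∪ {1})) {x : ℝ}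
    (hx : x ∈ Set.Icc (0 : ℝ) 1) :
    ε / 2 * ‖1 - a‖ ≤ ‖(x : ℂ) - a‖ := by
  obtain ⟨hε0, hε1⟩ := hε
  obtain ⟨hx0, hx1⟩ := hx
  have key : ε * (1 - x) ≤ ‖(x : ℂ) - a‖ := by
    by_contra! h
    have hx1' : 0 < 1 - x := by
      by_contra! h'
      nlinarith [norm_nonneg ((x : ℂ) - a)]
    have hxne : (1 - x : ℂ) ≠ 0 := by exact_mod_cast hx1'.ne'
    have hw : (a - x) / (1 - x : ℂ) ∈ Metric.closedBall (0 : ℂ) ε := by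
      have hnorm : ‖(1 - x : ℂ)‖ = 1 - x := by
        rw [← Complex.ofReal_one, ← Complex.ofReal_sub, Complex.norm_of_nonneg hx1'.le]
      rw [mem_closedBall_zero_iff, norm_div, hnorm, div_le_iff₀ hx1', norm_sub_rev]
      exact h.le
    apply ha
    have hcomb : a = x • (1 : ℂ) + (1 - x) • ((a - x) / (1 - x : ℂ)) := by
      simp only [Complex.real_smul]
      push_cast
      field_simp
      ring
    rw [hcomb]
    refine convex_convexHull ℝ _ ?_ ?_ hx0 hx1'.le (by ring)
    · exact subset_convexHull ℝ _ (Or.inr (Set.mem_singleton (1 : ℂ)))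
    · exact subset_convexHull ℝ _ (Or.inl hw)
  have htri : ‖1 - a‖ ≤ (1 - x) + ‖(x : ℂ) - a‖ := by
    have h := norm_add_le (((1 - x : ℝ) : ℂ)) ((x : ℂ) - a)
    rw [Complex.norm_of_nonneg (by linarith)] at h
    have hsum : ((1 - x : ℝ) : ℂ) + ((x : ℂ) - a) = 1 - a := by
      push_cast
      ring
    rwa [hsum] at h
  nlinarith [norm_nonneg ((x : ℂ) - a)]

theorem polynomial_lower_bound_on_segment
    (ε : ℝ) (hε : ε ∈ Set.Ioo (0 : ℝ) 1)
    (C : Set ℂ) (hC : C = convexHull ℝ (Metric.closedBall (0 : ℂ) ε ∪ {1}))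
    (p : Polynomial ℂ) (hp : ∀ z ∈ C, p.eval z ≠ 0) :
    ∀ x ∈ Set.Icc (0 : ℝ) 1,
      (ε / 2) ^ p.natDegree * ‖p.eval 1‖ ≤ ‖p.eval (x : ℂ)‖ := by
  intro x hx
  subst hC
  have hsplit := IsAlgClosed.splits p
  have heval (z : ℂ) :
      ‖p.eval z‖ = ‖p.leadingCoeff‖ * (p.roots.map fun a => ‖z - a‖).prod := by
    rw [hsplit.eval_eq_prod_roots, norm_mul]
    congr 1
    simpa using map_multiset_prod (normHom : ℂ →*₀ ℝ) (p.roots.map fun a => z - a)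
  have hprod : (p.roots.map fun a => ε / 2 * ‖1 - a‖).prod ≤
      (p.roots.map fun a => ‖(x : ℂ) - a‖).prod := by
    refine Multiset.prod_map_le_prod_map₀ _ _ (fun a _ => ?_) fun a ha => ?_
    · have := hε.1
      positivity
    · exact norm_one_sub_le_of_notMem_convexHull hε
        (fun h => hp a h (Polynomial.isRoot_of_mem_roots ha)) hx
  rw [Multiset.prod_map_mul, Multiset.map_const', Multiset.prod_replicate,
    ← hsplit.natDegree_eq_card_roots] at hprod
  rw [heval, heval, mul_left_comm]
  gcongr
end

section
/- Let ε ∈ (0,1) and let C be the convex hull in ℂ of the union of the closed ball of centre 0 and radius ε with the singleton {1}. Then for every z ∈ ℂ \ C, the distance from z to the segment [0,1] ⊆ ℂ satisfies dist(z, [0,1]) ≥ (ε/2) · |z − 1|. -/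
/-- A disc centred at `t ∈ [0,1]` of radius `ε * (1 - t)` lies in the convex hull of the disc of
radius `ε` about the origin and the point `1`. -/
theorem mem_convexHull_of_norm_sub_lt {ε t : ℝ} (ht : 0 ≤ t) {z : ℂ}
    (hz : ‖z - t‖ < ε * (1 - t)) (ht1 : t < 1) :
    z ∈ convexHull ℝ (Metric.closedBall (0 : ℂ) ε ∪ {1}) := by
  have hs : 0 < 1 - t := sub_pos.2 ht1
  have hball : (1 - t)⁻¹ • (z - t) ∈ Metric.closedBall (0 : ℂ) ε := by
    rw [mem_closedBall_zero_iff, norm_smul, Real.norm_of_nonneg (inv_nonneg.2 hs.le),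
      inv_mul_le_iff₀ hs, mul_comm (1 - t)]
    exact hz.le
  have hmem := convex_convexHull ℝ (Metric.closedBall (0 : ℂ) ε ∪ {1})
    (subset_convexHull ℝ _ (Or.inl hball)) (subset_convexHull ℝ _ (Or.inr rfl))
    hs.le ht (sub_add_cancel 1 t)
  rwa [smul_inv_smul₀ hs.ne', Complex.real_smul, mul_one, sub_add_cancel] at hmem

theorem dist_to_segment_ge
    (ε : ℝ) (hε : ε ∈ Set.Ioo (0 : ℝ) 1)
    (C : Set ℂ) (hC : C = convexHull ℝ (Metric.closedBall (0 : ℂ) ε ∪ {1})) :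
    ∀ z ∈ Cᶜ, ε / 2 * ‖z - 1‖ ≤ Metric.infDist z (segment ℝ (0 : ℂ) 1) := by
  intro z hz
  obtain ⟨hε0, hε1⟩ := hε
  rw [Metric.le_infDist ⟨0, left_mem_segment ℝ 0 1⟩]
  rintro y ⟨a, t, ha, ht, hat, rfl⟩
  have hpt : a • (0 : ℂ) + t • (1 : ℂ) = t := by simp
  rw [hpt, dist_eq_norm]
  have hfar : ε * (1 - t) ≤ ‖z - t‖ := by
    by_contra! hlt
    have ht1 : t < 1 := by
      have := pos_of_mul_pos_right ((norm_nonneg _).trans_lt hlt) hε0.le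
      linarith
    exact hz (hC ▸ mem_convexHull_of_norm_sub_lt ht hlt ht1)
  have hnorm : ‖(t : ℂ) - 1‖ = 1 - t := by
    rw [← Complex.ofReal_one, ← Complex.ofReal_sub, Complex.norm_real, Real.norm_eq_abs,
      abs_sub_comm, abs_of_nonneg (by linarith)]
  have htri : ‖z - 1‖ ≤ ‖z - t‖ + (1 - t) := hnorm ▸ norm_sub_le_norm_sub_add_norm_sub z t 1
  have hscaled := mul_le_mul_of_nonneg_left htri hε0.le
  have hshrink := mul_le_mul_of_nonneg_right hε1.le (norm_nonneg (z - t))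
  linarith
end

section
/- Let V ⊆ ℂⁿ be the common zero set of a finite family of polynomials in ℂ[z₁,…,zₙ], and let 𝕋ⁿ = {ζ ∈ ℂⁿ : |ζ_j| = 1 for all j} be the unit torus. Then the Hausdorff dimension of V ∩ 𝕋ⁿ is at most one half of the Hausdorff dimension of V: dimH(V ∩ 𝕋ⁿ) ≤ (1/2)·dimH(V). -/
open MeasureTheory Filter Set
open scoped ENNReal

noncomputable section

/-- We endow finite-dimensional complex Euclidean spaces with their Borel σ-algebra. -/
instance {ι : Type*} [Fintype ι] : MeasurableSpace (EuclideanSpace ℂ ι) := borel _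
instance {ι : Type*} [Fintype ι] : BorelSpace (EuclideanSpace ℂ ι) := ⟨rfl⟩

/-- Evaluation of a polynomial in the variables `ι` at a point of `ℂ^ι`. -/
def pEval {ι : Type*} (p : MvPolynomial ι ℂ) (z : EuclideanSpace ℂ ι) : ℂ :=
  MvPolynomial.eval (fun i => z i) p

/-- The open unit polydisc `𝔻ⁿ` in `ℂⁿ`. -/
def polydisc (n : ℕ) : Set (EuclideanSpace ℂ (Fin n)) := {z | ∀ j, ‖z j‖ < 1}

/-- The unit torus `𝕋^ι` in `ℂ^ι`. -/
def torus (ι : Type*) : Set (EuclideanSpace ℂ ι) := {ζ | ∀ j, ‖ζ j‖ = 1}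

/-- `φ` has radial limit `α` at `ζ`: `φ(ρζ) → α` as `ρ → 1⁻`. -/
def HasRadialLimit {n : ℕ} (φ : EuclideanSpace ℂ (Fin n) → ℂ)
    (ζ : EuclideanSpace ℂ (Fin n)) (α : ℂ) : Prop :=
  Tendsto (fun ρ : ℝ => φ ((ρ : ℂ) • ζ)) (nhdsWithin 1 (Set.Iio 1)) (nhds α)

/-- `φ` is the rational inner function `p/q` on the polydisc `𝔻ⁿ`: `p, q` have no common
nonconstant factor, `q` is zero-free on `𝔻ⁿ`, `|φ| < 1` on `𝔻ⁿ`, and for a.e. `ζ ∈ 𝕋ⁿ`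
(w.r.t. the Haar measure of `𝕋ⁿ`, i.e. up to an `ℋⁿ`-null set) the radial limit of `φ` at `ζ`
exists and is unimodular. -/
structure IsRationalInner (n : ℕ) (p q : MvPolynomial (Fin n) ℂ)
    (φ : EuclideanSpace ℂ (Fin n) → ℂ) : Prop where
  coprime : ∀ d : MvPolynomial (Fin n) ℂ, d ∣ p → d ∣ q → IsUnit d
  q_ne_zero : ∀ z ∈ polydisc n, pEval q z ≠ 0
  phi_eq : ∀ z ∈ polydisc n, φ z = pEval p z / pEval q z
  abs_lt_one : ∀ z ∈ polydisc n, ‖φ z‖ < 1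
  inner : ∃ E ⊆ torus (Fin n), μH[(n : ℝ)] E = 0 ∧
    ∀ ζ ∈ torus (Fin n) \ E, ∃ β : ℂ, ‖β‖ = 1 ∧ HasRadialLimit φ ζ β

/-- `μ` is a Clark measure of `φ` at `α`: a finite positive Borel measure on `𝕋ⁿ` whose
Poisson–Szegő integral is `(1-|φ|²)/|α-φ|²`. -/
def IsClarkMeasure (n : ℕ) (φ : EuclideanSpace ℂ (Fin n) → ℂ) (α : ℂ)
    (μ : Measure (EuclideanSpace ℂ (Fin n))) : Prop :=
  IsFiniteMeasure μ ∧ μ (torus (Fin n))ᶜ = 0 ∧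
    ∀ z ∈ polydisc n,
      ∫⁻ ζ, ENNReal.ofReal (∏ j, (1 - ‖z j‖ ^ 2) / ‖ζ j - z j‖ ^ 2) ∂μ
        = ENNReal.ofReal ((1 - ‖φ z‖ ^ 2) / ‖α - φ z‖ ^ 2)

/-- The subset of `L²(μ)` consisting of (classes of) holomorphic polynomial functions;
`H²(μ)` is its closure in `L²(μ)`. -/
def polyLp (n : ℕ) (μ : Measure (EuclideanSpace ℂ (Fin n))) : Set (Lp ℂ 2 μ) :=
  {f | ∃ p : MvPolynomial (Fin n) ℂ, ⇑f =ᵐ[μ] pEval p}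

/-- `φ₁⁻¹(α)`: the set of `ζ ∈ 𝕋ⁿ` where the radial limit of `φ` exists and equals `α`. -/
def radialFiber {n : ℕ} (φ : EuclideanSpace ℂ (Fin n) → ℂ) (α : ℂ) :
    Set (EuclideanSpace ℂ (Fin n)) :=
  {ζ | ζ ∈ torus (Fin n) ∧ HasRadialLimit φ ζ α}

/-- The common zero set in `ℂ^ι` of a finite family of real polynomials in the real and
imaginary parts of the coordinates. -/
def realZeroSet {ι : Type*} (s : Finset (MvPolynomial (ι × Bool) ℝ)) :
    Set (EuclideanSpace ℂ ι) :=
  {w | ∀ P ∈ s, MvPolynomial.eval (fun ib => if ib.2 then (w ib.1).re else (w ib.1).im) P = 0}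

/-- The projection `ℂⁿ → ℂ^{n-1}` deleting the `j`-th coordinate. -/
def deleteCoord {n : ℕ} (j : Fin n) (ζ : EuclideanSpace ℂ (Fin n)) :
    EuclideanSpace ℂ {i : Fin n // i ≠ j} :=
  (WithLp.equiv 2 _).symm fun i => ζ i.1

universe u

open MvPolynomial in
/-- A prime ideal `I` of a polynomial ring has a subfamily `e` of the variables which is
algebraically independent modulo `I` and over which every variable is algebraic modulo `I`,
in a separable way. -/
theorem exists_separable_equations {k σ : Type u} [Field k] [CharZero k] [Finite σ]
    (I : Ideal (MvPolynomial σ k)) [I.IsPrime] :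
    ∃ (κ : Type u) (_ : Fintype κ) (e : κ → σ) (q : σ → Polynomial (MvPolynomial κ k)),
      (∀ a : MvPolynomial κ k, rename e a ∈ I → a = 0) ∧ ∀ j, q j ≠ 0 ∧
        (q j).eval₂ (rename e : MvPolynomial κ k →ₐ[k] _).toRingHom (X j) ∈ I ∧
        (q j).derivative.eval₂ (rename e : MvPolynomial κ k →ₐ[k] _).toRingHom (X j) ∉ I := by
  let R := MvPolynomial σ k ⧸ I
  let x : σ → R := fun j => Ideal.Quotient.mkₐ k I (X j)
  have htop : Algebra.adjoin k (range x) = ⊤ := by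
    rw [show range x = Ideal.Quotient.mkₐ k I '' range X by rw [← range_comp]; rfl,
      ← AlgHom.map_adjoin, adjoin_range_X, Algebra.map_top, AlgHom.range_eq_top]
    exact Ideal.Quotient.mkₐ_surjective k I
  have halg : Algebra.IsAlgebraic (Algebra.adjoin k (range x)) R := by
    refine ⟨fun a => ?_⟩
    have ha : a ∈ Algebra.adjoin k (range x) := htop ▸ Algebra.mem_top
    exact isAlgebraic_algebraMap (⟨a, ha⟩ : Algebra.adjoin k (range x))
  obtain ⟨t, hts, ht⟩ := exists_isTranscendenceBasis_subset (R := k) (range x)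
  have := ((Set.finite_range x).subset hts).fintype
  choose e he using fun a : t => hts a.2
  have hcomp : (Ideal.Quotient.mkₐ k I).comp (rename e) = aeval ((↑) : t → R) := by
    ext a
    simpa [x] using he a
  have hcomp' : ∀ a, Ideal.Quotient.mk I (rename e a) = aeval ((↑) : t → R) a :=
    fun a => DFunLike.congr_fun hcomp a
  have hinj := algebraicIndependent_iff_injective_aeval.1 ht.1
  have heval : ∀ (p : Polynomial (MvPolynomial t k)) (j : σ),
      p.eval₂ (rename e : MvPolynomial t k →ₐ[k] MvPolynomial σ k).toRingHom (X j) ∈ I ↔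
        p.eval₂ (aeval ((↑) : t → R) : MvPolynomial t k →ₐ[k] R).toRingHom (x j) = 0 := by
    intro p j
    rw [← Ideal.Quotient.eq_zero_iff_mem, Polynomial.hom_eval₂, ← hcomp]
    rfl
  have hq : ∀ j, ∃ q : Polynomial (MvPolynomial t k), q ≠ 0 ∧
      q.eval₂ (aeval ((↑) : t → R) : MvPolynomial t k →ₐ[k] R).toRingHom (x j) = 0 := by
    intro j
    obtain ⟨p, hp0, hp⟩ := ht.isAlgebraic.1 (x j)
    refine ⟨p.map ht.1.aevalEquiv.symm.toRingEquiv.toRingHom, ?_, ?_⟩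
    · rwa [Ne, Polynomial.map_eq_zero_iff]
      exact ht.1.aevalEquiv.symm.injective
    · rw [Polynomial.eval₂_map, ← hp, Polynomial.aeval_def]
      congr 1
      ext a
      exact ht.1.aeval_repr a
  have hmin : ∀ j, ∃ q : Polynomial (MvPolynomial t k), q ≠ 0 ∧
      q.eval₂ (aeval ((↑) : t → R) : MvPolynomial t k →ₐ[k] R).toRingHom (x j) = 0 ∧
      q.derivative.eval₂ (aeval ((↑) : t → R) : MvPolynomial t k →ₐ[k] R).toRingHom (x j) ≠ 0 := by
    intro j
    obtain ⟨q, ⟨hq0, hqz⟩, hqm⟩ := exists_minimalFor_of_wellFoundedLT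
      (fun q : Polynomial (MvPolynomial t k) => q ≠ 0 ∧
      q.eval₂ (aeval ((↑) : t → R) : MvPolynomial t k →ₐ[k] R).toRingHom (x j) = 0)
      Polynomial.natDegree (hq j)
    refine ⟨q, hq0, hqz, fun hd => ?_⟩
    have hdeg : q.natDegree ≠ 0 := by
      intro h0
      rw [Polynomial.eq_C_of_natDegree_eq_zero h0, Polynomial.eval₂_C] at hqz
      refine hq0 ?_
      rw [Polynomial.eq_C_of_natDegree_eq_zero h0, hinj (hqz.trans (map_zero _).symm),
        Polynomial.C_0]
    have hlt := Polynomial.natDegree_derivative_lt hdeg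
    have hd0 : q.derivative ≠ 0 := fun h0 =>
      hdeg (Polynomial.derivative_eq_zero.1 h0)
    exact absurd (hqm ⟨hd0, hd⟩ hlt.le) (not_le.2 hlt)
  choose q hq0 hqz hqd using hmin
  refine ⟨t, this, e, q, fun a ha => hinj ?_, fun j => ⟨hq0 j, ?_, ?_⟩⟩
  · rw [← hcomp', Ideal.Quotient.eq_zero_iff_mem.2 ha, map_zero]
  · exact (heval _ _).2 (hqz j)
  · exact fun h => hqd j ((heval _ _).1 h)

open MvPolynomial in
/-- If every variable is algebraic modulo the prime ideal `I` over an algebraically independent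
subfamily `e` of the variables, then the projection of the zero locus of `I` to the coordinates
in `e` contains every point where no leading coefficient of the equations vanishes. -/
theorem exists_mem_zeroLocus_of_leadingCoeff_ne_zero {k σ κ : Type*} [Field k] [IsAlgClosed k]
    [Finite σ] (I : Ideal (MvPolynomial σ k)) [I.IsPrime] (e : κ → σ)
    (q : σ → Polynomial (MvPolynomial κ k))
    (hinj : ∀ a : MvPolynomial κ k, rename e a ∈ I → a = 0)
    (hq : ∀ j, (q j).eval₂ (rename e : MvPolynomial κ k →ₐ[k] _).toRingHom (X j) ∈ I)
    (y : κ → k) (hy : ∀ j, eval y (q j).leadingCoeff ≠ 0) :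
    ∃ z ∈ zeroLocus k I, ∀ i, z (e i) = y i := by
  let R := MvPolynomial σ k ⧸ I
  let K := FractionRing R
  let m : Ideal (MvPolynomial κ k) := RingHom.ker (eval y)
  have hm : m.IsPrime := RingHom.ker_isPrime _
  let ψ : MvPolynomial σ k →+* K := (algebraMap R K).comp (Ideal.Quotient.mk I)
  have hψ : ∀ p, ψ p = 0 ↔ p ∈ I := by
    intro p
    rw [← Ideal.Quotient.eq_zero_iff_mem]
    exact map_eq_zero_iff _ (IsFractionRing.injective R K)
  let φ : MvPolynomial κ k →+* K := ψ.comp (rename e : MvPolynomial κ k →ₐ[k] _).toRingHom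
  let A := Localization.AtPrime m
  have hunit : ∀ a : m.primeCompl, IsUnit (φ a) := by
    intro a
    refine IsUnit.mk0 _ fun h => a.2 ?_
    rw [hinj _ ((hψ _).1 h)]
    exact zero_mem _
  let φA : A →+* K := IsLocalization.lift hunit
  have hφA : ∀ a, φA (algebraMap _ A a) = φ a := fun a => IsLocalization.lift_eq hunit a
  let _ : Algebra A K := φA.toAlgebra
  let S := integralClosure A K
  have hint : ∀ j, IsIntegral A (ψ (X j)) := by
    intro j
    have hu : IsUnit ((q j).map (algebraMap (MvPolynomial κ k) A)).leadingCoeff := by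
      have hu' : IsUnit (algebraMap _ A (q j).leadingCoeff) :=
        IsLocalization.map_units A (⟨_, hy j⟩ : m.primeCompl)
      rwa [Polynomial.leadingCoeff_map_of_leadingCoeff_ne_zero _ hu'.ne_zero]
    refine ⟨_, Polynomial.monic_of_isUnit_leadingCoeff_inv_smul hu, ?_⟩
    rw [Units.smul_def, Polynomial.smul_eq_C_mul, Polynomial.eval₂_mul, Polynomial.eval₂_map]
    have hcomp : (algebraMap A K).comp (algebraMap (MvPolynomial κ k) A) = φ := RingHom.ext hφA
    rw [hcomp, ← Polynomial.hom_eval₂, (hψ _).2 (hq j), mul_zero]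
  obtain ⟨Q, hQ, hQm⟩ := Ideal.exists_ideal_over_prime_of_isIntegral_of_isDomain (S := S)
    (IsLocalRing.maximalIdeal A) (IsLocalRing.le_maximalIdeal (RingHom.ker_ne_top _))
  have hψS : ∀ p, ψ p ∈ S := by
    intro p
    induction p using MvPolynomial.induction_on with
    | C a =>
      have : ψ (C a) = algebraMap A K (algebraMap (MvPolynomial κ k) A (C a)) := by
        rw [show algebraMap A K _ = _ from hφA (C a)]
        simp [φ]
      rw [this]
      exact S.algebraMap_mem _
    | add p q hp hq => rw [map_add]; exact S.add_mem hp hq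
    | mul_X p j hp => rw [map_mul]; exact S.mul_mem hp (hint j)
  let ψS : MvPolynomial σ k →+* S := ψ.codRestrict S.toSubring hψS
  obtain ⟨M, hM, hQM⟩ := Ideal.exists_le_maximal (Q.comap ψS) (Ideal.IsPrime.ne_top inferInstance)
  obtain ⟨z, rfl⟩ := isMaximal_iff_eq_vanishingIdeal_singleton.1 hM
  refine ⟨z, fun p hp => ?_, fun i => ?_⟩
  · refine (mem_vanishingIdeal_singleton_iff _ _).1 (hQM ?_)
    have : ψS p = 0 := Subtype.ext ((hψ p).2 hp)
    rw [Ideal.mem_comap, this]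
    exact zero_mem _
  · have h1 : (X (e i) - C (y i) : MvPolynomial σ k) ∈ Q.comap ψS := by
      have h2 : algebraMap (MvPolynomial κ k) A (X i - C (y i)) ∈ IsLocalRing.maximalIdeal A := by
        rw [IsLocalization.AtPrime.to_map_mem_maximal_iff A m]
        simp [m, RingHom.mem_ker]
      rw [← hQm, Ideal.mem_comap] at h2
      rw [Ideal.mem_comap]
      convert h2 using 1
      apply Subtype.ext
      change ψ _ = φA _
      rw [hφA]
      simp [φ]
    have h3 := (mem_vanishingIdeal_singleton_iff _ _).1 (hQM h1)
    simpa [sub_eq_zero] using h3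

open MvPolynomial in
theorem MvPolynomial.hasStrictFDerivAt_eval {𝕜 σ : Type*} [NontriviallyNormedField 𝕜] [Fintype σ]
    (p : MvPolynomial σ 𝕜) (z : σ → 𝕜) :
    HasStrictFDerivAt (fun w : σ → 𝕜 => eval w p)
      (∑ i, eval z (pderiv i p) • ContinuousLinearMap.proj (R := 𝕜) (φ := fun _ => 𝕜) i) z := by
  classical
  induction p using MvPolynomial.induction_on with
  | C a =>
    simp only [eval_C]
    exact (hasStrictFDerivAt_const a z).congr_fderiv (by ext v; simp)
  | add p q hp hq =>
    simp only [map_add]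
    exact (hp.add hq).congr_fderiv (by ext v; simp [add_mul, Finset.sum_add_distrib])
  | mul_X p j hp =>
    have hj : HasStrictFDerivAt (fun w : σ → 𝕜 => w j)
        (ContinuousLinearMap.proj (R := 𝕜) (φ := fun _ => 𝕜) j) z :=
      (ContinuousLinearMap.proj (R := 𝕜) (φ := fun _ => 𝕜) j).hasStrictFDerivAt
    simp only [map_mul, eval_X]
    refine (hp.mul hj).congr_fderiv ?_
    ext v
    simp [Derivation.leibniz, pderiv_X, Pi.single_apply, add_mul, Finset.sum_add_distrib,
      Finset.mul_sum, mul_assoc, apply_ite]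

open MvPolynomial in
/-- The partial derivatives of a polynomial in `X j` with coefficients in the variables `e`. -/
theorem MvPolynomial.pderiv_eval₂_rename {R σ κ : Type*} [CommRing R] (e : κ → σ)
    (q : Polynomial (MvPolynomial κ R)) {i : σ} (hi : i ∉ range e) (j : σ) :
    pderiv i (q.eval₂ (rename e : MvPolynomial κ R →ₐ[R] _).toRingHom (X j)) =
      q.derivative.eval₂ (rename e : MvPolynomial κ R →ₐ[R] _).toRingHom (X j) *
        pderiv i (X j) := by
  classical
  have hren : ∀ a : MvPolynomial κ R, pderiv i (rename e a) = 0 := fun a =>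
    pderiv_eq_zero_of_notMem_vars fun h => by
      obtain ⟨b, -, rfl⟩ := Finset.mem_image.1 (vars_rename e a h)
      exact hi ⟨b, rfl⟩
  induction q using Polynomial.induction_on' with
  | add p q hp hq =>
    rw [Polynomial.eval₂_add, map_add, hp, hq, Polynomial.derivative_add, Polynomial.eval₂_add,
      add_mul]
  | monomial n a =>
    simp [Polynomial.eval₂_monomial, Polynomial.derivative_monomial, Derivation.leibniz,
      Derivation.leibniz_pow, hren, smul_eq_mul]
    ring

/-- A map which is strictly differentiable with injective derivative at every point of a set does
not decrease the Hausdorff dimension of that set. -/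
theorem dimH_le_of_hasStrictFDerivAt_injective {E F : Type*} [NormedAddCommGroup E]
    [NormedSpace ℂ E] [FiniteDimensional ℂ E] [NormedAddCommGroup F] [NormedSpace ℂ F]
    {f : E → F} {f' : E → E →L[ℂ] F} {W : Set E}
    (hf : ∀ x ∈ W, HasStrictFDerivAt f (f' x) x) (hf' : ∀ x ∈ W, Function.Injective (f' x)) :
    dimH W ≤ dimH (f '' W) := by
  have := FiniteDimensional.proper ℂ E
  by_contra! h
  obtain ⟨x, hx, hlt⟩ := exists_mem_nhdsWithin_lt_dimH_of_lt_dimH h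
  obtain ⟨C, hC, hanti⟩ := (f' x).toLinearMap.exists_antilipschitzWith
    (LinearMap.ker_eq_bot.2 (hf' x hx))
  obtain ⟨N, hN, happ⟩ := (hf x hx).approximates_deriv_on_nhds (c := C⁻¹ / 2)
    (Or.inr (by positivity))
  have hr : AntilipschitzWith (C⁻¹ - C⁻¹ / 2)⁻¹ (N.domRestrict f) := by
    have hlt' : C⁻¹ / 2 < C⁻¹ := NNReal.half_lt_self (by positivity)
    convert! (hanti.domRestrict N).add_lipschitzWith happ.lipschitz_sub hlt'
    simp [domRestrict]
  refine absurd (hlt (W ∩ N) (inter_mem self_mem_nhdsWithin (mem_nhdsWithin_of_mem_nhds hN)))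
    (not_lt.2 ?_)
  have h1 : Subtype.val '' (Subtype.val ⁻¹' W : Set N) = W ∩ N := by
    rw [Subtype.image_preimage_coe, inter_comm]
  rw [← h1, isometry_subtype_coe.dimH_image]
  refine (hr.le_dimH_image _).trans (dimH_mono ?_)
  rintro _ ⟨w, hw, rfl⟩
  exact ⟨w, hw, rfl⟩

open MvPolynomial in
/-- A subset of `ℂ^σ` whose projection to the coordinates in `e` contains a nonempty Zariski open
set has Hausdorff dimension at least twice the number of these coordinates. -/
theorem two_mul_card_le_dimH {σ κ : Type*} [Fintype σ] [Fintype κ] (e : κ → σ)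
    {c : MvPolynomial κ ℂ} (hc : c ≠ 0) {Z : Set (σ → ℂ)}
    (hZ : ∀ y : κ → ℂ, eval y c ≠ 0 → ∃ z ∈ Z, ∀ i, z (e i) = y i) :
    2 * (Fintype.card κ : ℝ≥0∞) ≤ dimH Z := by
  have hopen : IsOpen {y : κ → ℂ | eval y c ≠ 0} :=
    isOpen_ne_fun (MvPolynomial.continuous_eval c) continuous_const
  obtain ⟨y, hy⟩ : ∃ y : κ → ℂ, eval y c ≠ 0 := by
    by_contra! h
    exact hc (MvPolynomial.funext fun y => by rw [h y, map_zero])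
  have hdim := Real.dimH_of_mem_nhds (hopen.mem_nhds hy)
  have hrank : Module.finrank ℝ (κ → ℂ) = 2 * Fintype.card κ := by
    simp [Module.finrank_pi_fintype, mul_comm]
  rw [hrank] at hdim
  push_cast at hdim
  have hlip : LipschitzWith 1 (fun z : σ → ℂ => z ∘ e) :=
    LipschitzWith.of_dist_le_mul fun z w => by
      rw [NNReal.coe_one, one_mul, dist_pi_le_iff dist_nonneg]
      exact fun i => dist_le_pi_dist z w (e i)
  rw [← hdim]
  refine (dimH_mono fun y hy => ?_).trans (hlip.dimH_image_le Z)
  obtain ⟨z, hz, hzy⟩ := hZ y hy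
  exact ⟨z, hz, funext hzy⟩

open MvPolynomial in
/-- The torus points satisfying, for every coordinate `j`, an equation in `z j` and the coordinates
in `e` which is separable in `z j`, form a set of Hausdorff dimension at most the number of
coordinates in `e`. -/
theorem dimH_torus_separable_le_card {σ κ : Type*} [Fintype σ] [Fintype κ] (e : κ → σ)
    (q : σ → Polynomial (MvPolynomial κ ℂ)) {W : Set (σ → ℂ)}
    (hW : ∀ z ∈ W, ∀ j, ‖z j‖ = 1)
    (hq : ∀ z ∈ W, ∀ j,
      eval z ((q j).eval₂ (rename e : MvPolynomial κ ℂ →ₐ[ℂ] _).toRingHom (X j)) = 0)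
    (hd : ∀ z ∈ W, ∀ j,
      eval z ((q j).derivative.eval₂ (rename e : MvPolynomial κ ℂ →ₐ[ℂ] _).toRingHom (X j)) ≠ 0) :
    dimH W ≤ Fintype.card κ := by
  classical
  let P : σ → MvPolynomial σ ℂ := fun j =>
    (q j).eval₂ (rename e : MvPolynomial κ ℂ →ₐ[ℂ] _).toRingHom (X j)
  let f : (σ → ℂ) → (κ → ℂ) × (σ → ℂ) := fun z => (fun i => z (e i), fun j => eval z (P j))
  let f' : (σ → ℂ) → (σ → ℂ) →L[ℂ] (κ → ℂ) × (σ → ℂ) := fun z =>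
    (ContinuousLinearMap.pi fun i =>
      ContinuousLinearMap.proj (R := ℂ) (φ := fun _ : σ => ℂ) (e i)).prod
    (ContinuousLinearMap.pi fun j => ∑ i, eval z (pderiv i (P j)) •
      ContinuousLinearMap.proj (R := ℂ) (φ := fun _ : σ => ℂ) i)
  have hf : ∀ z, HasStrictFDerivAt f (f' z) z := fun z =>
    HasStrictFDerivAt.prodMk (ContinuousLinearMap.hasStrictFDerivAt
        (ContinuousLinearMap.pi fun i =>
          ContinuousLinearMap.proj (R := ℂ) (φ := fun _ : σ => ℂ) (e i)))
      (hasStrictFDerivAt_pi.2 fun j => (P j).hasStrictFDerivAt_eval z)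
  have hinj : ∀ z ∈ W, Function.Injective (f' z) := by
    intro z hz
    rw [injective_iff_map_eq_zero]
    intro v hv
    have hv1 : ∀ i, v (e i) = 0 := fun i => congr_fun (congr_arg Prod.fst hv) i
    have hv2 : ∀ j, ∑ i, eval z (pderiv i (P j)) * v i = 0 := fun j => by
      simpa [f'] using congr_fun (congr_arg Prod.snd hv) j
    ext j
    by_cases hj : j ∈ range e
    · obtain ⟨i, rfl⟩ := hj
      exact hv1 i
    · have h := hv2 j
      rw [Finset.sum_eq_single j] at h
      · rw [pderiv_eval₂_rename e _ hj, pderiv_X_self, mul_one] at h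
        exact (mul_eq_zero.1 h).resolve_left (hd z hz j)
      · intro i _ hij
        by_cases hi : i ∈ range e
        · obtain ⟨i, rfl⟩ := hi
          rw [hv1, mul_zero]
        · rw [pderiv_eval₂_rename e _ hi, pderiv_X_of_ne hij.symm, mul_zero, map_zero, zero_mul]
      · simp
  let g : (κ → ℝ) → (κ → ℂ) × (σ → ℂ) := fun θ => (fun i => Complex.exp (θ i * Complex.I), 0)
  have hg : ContDiff ℝ 1 g := by
    refine ContDiff.prodMk (contDiff_pi.2 fun i => ?_) contDiff_const
    refine ContDiff.cexp (ContDiff.mul ?_ contDiff_const)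
    exact Complex.ofRealCLM.contDiff.comp (contDiff_apply ℝ ℝ i)
  calc dimH W ≤ dimH (f '' W) := dimH_le_of_hasStrictFDerivAt_injective (fun z _ => hf z) hinj
    _ ≤ dimH (range g) := by
      refine dimH_mono ?_
      rintro _ ⟨z, hz, rfl⟩
      refine ⟨fun i => (z (e i)).arg, Prod.ext (funext fun i => ?_) (funext fun j => ?_)⟩
      · simpa [hW z hz] using Complex.norm_mul_exp_arg_mul_I (z (e i))
      · exact (hq z hz j).symm
    _ ≤ Module.finrank ℝ (κ → ℝ) := hg.dimH_range_le
    _ = Fintype.card κ := by rw [Module.finrank_fintype_fun_eq_card]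

open MvPolynomial in
theorem MvPolynomial.mem_zeroLocus_sup_span_singleton {k σ : Type*} [Field k]
    {I : Ideal (MvPolynomial σ k)} {z : σ → k} (hz : z ∈ zeroLocus k I) {a : MvPolynomial σ k}
    (ha : aeval z a = 0) : z ∈ zeroLocus k (I ⊔ Ideal.span {a}) := by
  have hle : I ⊔ Ideal.span {a} ≤ vanishingIdeal k {z} :=
    sup_le (fun p hp => (mem_vanishingIdeal_singleton_iff z p).2 (hz p hp))
      ((Ideal.span_singleton_le_iff_mem _).2 ((mem_vanishingIdeal_singleton_iff z a).2 ha))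
  exact fun p hp => (mem_vanishingIdeal_singleton_iff z p).1 (hle hp)

open MvPolynomial in
theorem MvPolynomial.zeroLocus_subset_union_of_mul_mem {k σ : Type*} [Field k]
    {I : Ideal (MvPolynomial σ k)} {a b : MvPolynomial σ k} (hab : a * b ∈ I) :
    zeroLocus k I ⊆ zeroLocus k (I ⊔ Ideal.span {a}) ∪ zeroLocus k (I ⊔ Ideal.span {b}) := by
  intro z hz
  have h := hz _ hab
  rw [map_mul, mul_eq_zero] at h
  exact h.imp (mem_zeroLocus_sup_span_singleton hz) (mem_zeroLocus_sup_span_singleton hz)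

open MvPolynomial in
/-- The torus part of the zero locus of a polynomial ideal has at most half the Hausdorff dimension
of the zero locus. -/
theorem dimH_zeroLocus_inter_torus_le {σ : Type} [Fintype σ] (I : Ideal (MvPolynomial σ ℂ)) :
    dimH (zeroLocus ℂ I ∩ {z | ∀ j, ‖z j‖ = 1}) ≤ (1 / 2 : ℝ≥0∞) * dimH (zeroLocus ℂ I) := by
  induction I using WellFoundedGT.induction with
  | ind I ih =>
  have hsup : ∀ a ∉ I, dimH (zeroLocus ℂ (I ⊔ Ideal.span {a}) ∩ {z | ∀ j, ‖z j‖ = 1}) ≤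
      (1 / 2 : ℝ≥0∞) * dimH (zeroLocus ℂ I) := by
    intro a ha
    have hlt : I < I ⊔ Ideal.span {a} := by
      rw [left_lt_sup, Ideal.span_singleton_le_iff_mem]
      exact ha
    refine (ih _ hlt).trans ?_
    have hsub : zeroLocus ℂ (I ⊔ Ideal.span {a}) ⊆ zeroLocus ℂ I :=
      fun z hz p hp => hz p (le_sup_left (a := I) hp)
    exact mul_le_mul' le_rfl (dimH_mono hsub)
  by_cases hI : I.IsPrime
  · obtain ⟨κ, _, e, q, hinj, hq⟩ := exists_separable_equations I
    choose hq0 hqI hqd using hq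
    have hlow : 2 * (Fintype.card κ : ℝ≥0∞) ≤ dimH (zeroLocus ℂ I) := by
      refine two_mul_card_le_dimH e (c := ∏ j, (q j).leadingCoeff)
        (Finset.prod_ne_zero_iff.2 fun j _ => Polynomial.leadingCoeff_ne_zero.2 (hq0 j)) ?_
      intro y hy
      rw [map_prod, Finset.prod_ne_zero_iff] at hy
      exact exists_mem_zeroLocus_of_leadingCoeff_ne_zero I e q hinj hqI y
        fun j => hy j (Finset.mem_univ j)
    let d : MvPolynomial σ ℂ := ∏ j,
      (q j).derivative.eval₂ (rename e : MvPolynomial κ ℂ →ₐ[ℂ] _).toRingHom (X j)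
    have hdI : d ∉ I := fun h => by
      obtain ⟨j, -, hj⟩ := hI.prod_mem_iff.1 h
      exact hqd j hj
    let W : Set (σ → ℂ) := {z | z ∈ zeroLocus ℂ I ∧ (∀ j, ‖z j‖ = 1) ∧ eval z d ≠ 0}
    have hW : dimH W ≤ Fintype.card κ := by
      refine dimH_torus_separable_le_card e q (fun z hz => hz.2.1) (fun z hz j => ?_)
        (fun z hz j => ?_)
      · exact hz.1 _ (hqI j)
      · have h := hz.2.2
        rw [map_prod, Finset.prod_ne_zero_iff] at h
        exact h j (Finset.mem_univ j)
    have hsub : zeroLocus ℂ I ∩ {z | ∀ j, ‖z j‖ = 1} ⊆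
        (zeroLocus ℂ (I ⊔ Ideal.span {d}) ∩ {z | ∀ j, ‖z j‖ = 1}) ∪ W := by
      rintro z ⟨hz, hzT⟩
      by_cases hd : eval z d = 0
      · exact Or.inl ⟨mem_zeroLocus_sup_span_singleton hz hd, hzT⟩
      · exact Or.inr ⟨hz, hzT, hd⟩
    refine (dimH_mono hsub).trans ?_
    rw [dimH_union]
    refine max_le (hsup d hdI) (hW.trans ?_)
    rw [one_div, ← ENNReal.div_eq_inv_mul, ENNReal.le_div_iff_mul_le (by simp) (by simp), mul_comm]
    exact hlow
  · rcases Ideal.not_isPrime_iff.1 hI with rfl | ⟨a, ha, b, hb, hab⟩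
    · simp
    · refine (dimH_mono (inter_subset_inter_left _ (zeroLocus_subset_union_of_mul_mem hab))).trans ?_
      rw [union_inter_distrib_right, dimH_union]
      exact max_le (hsup a ha) (hsup b hb)

/-- The Hausdorff dimension of the intersection of a complex algebraic set with the unit
torus is at most half the Hausdorff dimension of the algebraic set. -/
theorem dimH_inter_torus_le {n : ℕ} (s : Finset (MvPolynomial (Fin n) ℂ))
    (V : Set (EuclideanSpace ℂ (Fin n))) (hV : V = {z | ∀ p ∈ s, pEval p z = 0}) :
    dimH (V ∩ torus (Fin n)) ≤ (1 / 2 : ℝ≥0∞) * dimH V := by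
  let L : EuclideanSpace ℂ (Fin n) ≃L[ℝ] (Fin n → ℂ) :=
    PiLp.continuousLinearEquiv 2 ℝ (fun _ : Fin n => ℂ)
  let I : Ideal (MvPolynomial (Fin n) ℂ) := Ideal.span s
  have hVI : V = L ⁻¹' MvPolynomial.zeroLocus ℂ I := by
    rw [MvPolynomial.zeroLocus_span, hV]
    rfl
  have hT : V ∩ torus (Fin n) = L ⁻¹' (MvPolynomial.zeroLocus ℂ I ∩ {z | ∀ j, ‖z j‖ = 1}) := by
    rw [hVI]
    rfl
  rw [hT, hVI, L.dimH_preimage, L.dimH_preimage]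
  exact dimH_zeroLocus_inter_torus_le I

end
end

section
/- Let φ be a rational inner function on the polydisc 𝔻ⁿ, written φ = p/q with p, q ∈ ℂ[z₁,…,zₙ] having no common nonconstant polynomial factor and q zero-free on 𝔻ⁿ. Then the set N := {ζ ∈ 𝕋ⁿ : q(ζ) = 0} satisfies ℋ^{n−1}(N) = 0, where ℋ^{n−1} is the (n−1)-dimensional Hausdorff measure on ℂⁿ. -/
open MeasureTheory Filter Set
open scoped ENNReal

noncomputable section

section Algebra

open Polynomial in
/-- Two polynomials over a UFD without common nonunit factor have a nonzero constant in the ideal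
they generate. -/
theorem Polynomial.exists_mul_add_mul_eq_C_of_isRelPrime {R : Type*} [CommRing R] [IsDomain R]
    [UniqueFactorizationMonoid R] {f g : R[X]} (h : IsRelPrime f g) :
    ∃ (a b : R[X]) (r : R), r ≠ 0 ∧ a * f + b * g = C r := by
  classical
  let _ : NormalizedGCDMonoid R := Nonempty.some inferInstance
  let K := FractionRing R
  let m : R[X] →+* K[X] := mapRingHom (algebraMap R K)
  have hinj : Function.Injective (algebraMap R K) := IsFractionRing.injective R K
  have hminj : Function.Injective m := map_injective _ hinj
  have hcop : IsCoprime (m f) (m g) := by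
    refine isCoprime_of_irreducible_dvd ?_ fun d hd hdf hdg => hd.not_isUnit ?_
    · rintro ⟨hf, hg⟩
      rw [map_eq_zero_iff m hminj] at hf hg
      subst hf hg
      exact not_isUnit_zero (h dvd_rfl dvd_rfl)
    · obtain ⟨b, hb, hN⟩ := IsLocalization.integerNormalization_spec (nonZeroDivisors R) d
      set N := IsLocalization.integerNormalization (nonZeroDivisors R) d
      have hb0 : algebraMap R K b ≠ 0 := by
        rw [Ne, map_eq_zero_iff _ hinj]
        exact nonZeroDivisors.ne_zero hb
      have hbd : m N = C (algebraMap R K b) * d := by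
        change N.map _ = _
        rw [hN, algebra_compatible_smul K b d, smul_eq_C_mul]
      have hbu : IsUnit (C (algebraMap R K b)) := isUnit_C.2 hb0.isUnit
      have hdvd : ∀ e : R[X], d ∣ m e → N.primPart ∣ e := fun e he => by
        refine N.isPrimitive_primPart.dvd_of_fraction_map_dvd_fraction_map (K := K) ?_
        have h1 : m N.primPart ∣ m N := _root_.map_dvd m N.primPart_dvd
        exact h1.trans (by rw [hbd]; exact hbu.mul_left_dvd.2 he)
      have hu : IsUnit (m N.primPart) := (h (hdvd f hdf) (hdvd g hdg)).map m
      have hN0 : N ≠ 0 := fun h0 => by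
        rw [h0, map_zero] at hbd
        exact mul_ne_zero hbu.ne_zero hd.ne_zero hbd.symm
      have hNu : IsUnit (m N) := by
        rw [N.eq_C_content_mul_primPart, map_mul]
        refine IsUnit.mul ?_ hu
        change IsUnit ((C N.content).map (algebraMap R K))
        rw [map_C, isUnit_C, isUnit_iff_ne_zero, Ne, map_eq_zero_iff _ hinj, content_eq_zero_iff]
        exact hN0
      rw [hbd] at hNu
      exact isUnit_of_mul_isUnit_right hNu
  obtain ⟨a, b, hab⟩ := hcop
  obtain ⟨s, hs, hA⟩ := IsLocalization.integerNormalization_spec (nonZeroDivisors R) a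
  obtain ⟨t, ht, hB⟩ := IsLocalization.integerNormalization_spec (nonZeroDivisors R) b
  refine ⟨C t * IsLocalization.integerNormalization (nonZeroDivisors R) a,
    C s * IsLocalization.integerNormalization (nonZeroDivisors R) b, s * t,
    mul_ne_zero (nonZeroDivisors.ne_zero hs) (nonZeroDivisors.ne_zero ht), hminj ?_⟩
  rw [algebra_compatible_smul K, smul_eq_C_mul] at hA hB
  simp only [m, coe_mapRingHom, Polynomial.map_add, Polynomial.map_mul, hA, hB, map_C, map_mul]
    at hab ⊢
  linear_combination (C (algebraMap R K s) * C (algebraMap R K t)) * hab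

/-- Two relatively prime multivariate polynomials have a nonzero polynomial not involving the
variable `i` in the ideal they generate. -/
theorem MvPolynomial.exists_mul_add_mul_eq_rename_of_isRelPrime {k ι : Type*} [Field k]
    (i : ι) {p q : MvPolynomial ι k} (h : IsRelPrime p q) :
    ∃ (a b : MvPolynomial ι k) (r : MvPolynomial {j // j ≠ i} k), r ≠ 0 ∧
      a * p + b * q = rename Subtype.val r := by
  classical
  let e : MvPolynomial ι k ≃ₐ[k] Polynomial (MvPolynomial {j // j ≠ i} k) :=
    (renameEquiv k (Equiv.optionSubtypeNe i).symm).trans (optionEquivLeft k {j // j ≠ i})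
  have he : ∀ r, e (rename Subtype.val r) = Polynomial.C r := fun r => by
    induction r using MvPolynomial.induction_on with
    | C c => simp [e]
    | add p q hp hq => simp only [map_add, hp, hq]
    | mul_X p j hp =>
      simp only [map_mul, hp, rename_X]
      simp [e, Equiv.optionSubtypeNe_symm_of_ne j.2]
  have h' : IsRelPrime (e p) (e q) := by
    refine IsRelPrime.of_map e.symm ?_
    simpa using h
  obtain ⟨a, b, r, hr, hab⟩ := Polynomial.exists_mul_add_mul_eq_C_of_isRelPrime h'
  refine ⟨e.symm a, e.symm b, r, hr, e.injective ?_⟩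
  simp [he, hab]

/-- Some iterated partial derivative of a nonzero polynomial does not vanish at a given point. -/
theorem MvPolynomial.exists_eval_foldl_pderiv_ne_zero {k ι : Type*} [Field k] [CharZero k]
    (x : ι → k) {f : MvPolynomial ι k} (hf : f ≠ 0) :
    ∃ L : List ι, eval x (L.foldl (fun g i => pderiv i g) f) ≠ 0 := by
  classical
  suffices H : ∀ (d : ℕ) (f : MvPolynomial ι k), f ≠ 0 → (∀ m ∈ f.support, m.degree ≤ d) →
      ∃ L : List ι, eval x (L.foldl (fun g i => pderiv i g) f) ≠ 0 from
    H _ f hf fun m hm => Finset.le_sup (f := Finsupp.degree) hm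
  intro d
  induction d with
  | zero =>
    intro f hf hd
    refine ⟨[], ?_⟩
    have hc : f = C (coeff 0 f) := by
      ext m
      rw [coeff_C]
      split_ifs with hm
      · rw [hm]
      · by_contra hne
        have := hd m (mem_support_iff.2 hne)
        exact hm ((Finsupp.degree_eq_zero_iff m).1 (Nat.le_zero.1 this)).symm
    rw [hc] at hf ⊢
    simpa using hf
  | succ d ih =>
    intro f hf hd
    by_cases h : ∃ i, pderiv i f ≠ 0
    · obtain ⟨i, hi⟩ := h
      obtain ⟨L, hL⟩ := ih (pderiv i f) hi fun m hm => by
        rw [mem_support_iff, coeff_pderiv] at hm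
        have := hd _ (mem_support_iff.2 (left_ne_zero_of_mul hm))
        simpa using this
      exact ⟨i :: L, hL⟩
    · push Not at h
      refine ih f hf fun m hm => ?_
      by_cases hm0 : m = 0
      · simp [hm0]
      · exfalso
        obtain ⟨i, hi⟩ := Finsupp.ne_iff.1 hm0
        have h1 := congrArg (coeff (m - Finsupp.single i 1)) (h i)
        have hle : Finsupp.single i 1 ≤ m := by
          rw [Finsupp.single_le_iff]; exact Nat.one_le_iff_ne_zero.2 hi
        rw [coeff_pderiv, tsub_add_cancel_of_le hle, coeff_zero] at h1
        exact mul_ne_zero (mem_support_iff.1 hm) (by norm_cast) h1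

end Algebra

section Analysis

/-- A map with injective strict derivative is locally antilipschitz. -/
theorem HasStrictFDerivAt.exists_mem_nhds_le_mul_norm_sub {𝕜 E F : Type*}
    [NontriviallyNormedField 𝕜] [CompleteSpace 𝕜] [NormedAddCommGroup E] [NormedSpace 𝕜 E]
    [FiniteDimensional 𝕜 E] [NormedAddCommGroup F] [NormedSpace 𝕜 F] {f : E → F} {f' : E →L[𝕜] F}
    {x : E} (hf : HasStrictFDerivAt f f' x) (hf' : Function.Injective f') :
    ∃ u ∈ nhds x, ∃ K : NNReal, ∀ y ∈ u, ∀ z ∈ u, ‖y - z‖ ≤ K * ‖f y - f z‖ := by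
  obtain ⟨K, hK0, hK⟩ := f'.toLinearMap.exists_antilipschitzWith (LinearMap.ker_eq_bot.2 hf')
  obtain ⟨u, hu, hfu⟩ := hf.approximates_deriv_on_nhds (c := (2 * K)⁻¹) (Or.inr (by positivity))
  refine ⟨u, hu, 2 * K, fun y hy z hz => ?_⟩
  have h1 := hfu y hy z hz
  have h2 : ‖y - z‖ ≤ K * ‖f' (y - z)‖ := ZeroHomClass.bound_of_antilipschitz f' hK (y - z)
  have h3 : ‖f' (y - z)‖ ≤ ‖f y - f z‖ + ‖f y - f z - f' (y - z)‖ := by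
    rw [← norm_sub_rev (f' (y - z))]
    simpa using norm_add_le (f y - f z) (f' (y - z) - (f y - f z))
  have hK' : (0 : ℝ) < K := hK0
  have h4 : (K : ℝ) * (((2 * K)⁻¹ : NNReal) * ‖y - z‖) = ‖y - z‖ / 2 := by
    push_cast
    field_simp
  have h5 : (K : ℝ) * ‖f' (y - z)‖ ≤ K * (‖f y - f z‖ + ((2 * K)⁻¹ : NNReal) * ‖y - z‖) := by
    gcongr
    exact h3.trans (by gcongr)
  rw [mul_add, h4] at h5
  push_cast
  linarith

/-- A set is Hausdorff-null if its image under a map expanding distances up to a constant is. -/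
theorem hausdorffMeasure_eq_zero_of_image {X Y : Type*} [MetricSpace X] [MetricSpace Y]
    [MeasurableSpace X] [BorelSpace X] [MeasurableSpace Y] [BorelSpace Y] {f : X → Y} {s : Set X}
    {K : NNReal} (hf : ∀ x ∈ s, ∀ y ∈ s, dist x y ≤ K * dist (f x) (f y)) {d : ℝ} (hd : 0 ≤ d)
    (h : μH[d] (f '' s) = 0) : μH[d] s = 0 := by
  have ha : AntilipschitzWith K (s.domRestrict f) :=
    AntilipschitzWith.of_le_mul_dist fun x y => hf x x.2 y y.2
  have h1 := ha.le_hausdorffMeasure_image hd univ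
  rw [image_univ, range_domRestrict, h, mul_zero, nonpos_iff_eq_zero] at h1
  have h2 := (isometry_subtype_coe (s := s)).hausdorffMeasure_image (Or.inl hd) univ
  rwa [image_univ, Subtype.range_coe, h1] at h2

variable {ι : Type*} [Fintype ι]

theorem hasStrictFDerivAt_pEval (g : MvPolynomial ι ℂ) (z : EuclideanSpace ℂ ι) :
    HasStrictFDerivAt (𝕜 := ℂ) (pEval g)
      (∑ i, pEval (MvPolynomial.pderiv i g) z • (EuclideanSpace.proj i : EuclideanSpace ℂ ι →L[ℂ] ℂ))
      z := by
  classical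
  induction g using MvPolynomial.induction_on with
  | C c =>
    have : pEval (MvPolynomial.C (σ := ι) c) = fun _ => c := by ext; simp [pEval]
    rw [this]
    refine (hasStrictFDerivAt_const c z).congr_fderiv ?_
    ext v
    simp [pEval]
  | add p q hp hq =>
    have : pEval (p + q) = fun z => pEval p z + pEval q z := by ext; simp [pEval]
    rw [this]
    refine (hp.add hq).congr_fderiv ?_
    ext v
    simp [pEval, add_mul, Finset.sum_add_distrib]
  | mul_X p j hp =>
    have : pEval (p * MvPolynomial.X j) = fun z => pEval p z * z j := by ext; simp [pEval]
    rw [this]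
    refine (hp.mul (EuclideanSpace.proj j : EuclideanSpace ℂ ι →L[ℂ] ℂ).hasStrictFDerivAt).congr_fderiv
      ?_
    ext v
    simp [pEval, MvPolynomial.pderiv_X, Pi.single_apply, Finset.mul_sum, add_mul,
      Finset.sum_add_distrib, apply_ite, mul_assoc]

theorem continuous_pEval (g : MvPolynomial ι ℂ) : Continuous (pEval g) :=
  continuous_iff_continuousAt.2 fun z => (hasStrictFDerivAt_pEval g z).hasFDerivAt.continuousAt

/-- The torus `𝕋^ι` has Hausdorff dimension at most the number of coordinates. -/
theorem hausdorffMeasure_torus_eq_zero {d : ℝ} (hd : Fintype.card ι < d) :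
    μH[d] (torus ι) = 0 := by
  let c : (ι → ℝ) → EuclideanSpace ℂ ι := fun t =>
    WithLp.toLp 2 fun j => Complex.exp (t j * Complex.I)
  have hc : ContDiff ℝ 1 c := by
    refine contDiff_piLp' 2 fun j => ?_
    change ContDiff ℝ 1 fun t : ι → ℝ => Complex.exp (t j * Complex.I)
    have : ContDiff ℝ 1 fun t : ι → ℝ => ((t j : ℝ) : ℂ) :=
      Complex.ofRealCLM.contDiff.comp (contDiff_apply ℝ ℝ j)
    exact (this.mul contDiff_const).cexp
  have hsub : torus ι ⊆ range c := fun z hz => by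
    refine ⟨fun j => (z j).arg, ?_⟩
    ext j
    have := Complex.norm_mul_exp_arg_mul_I (z j)
    rw [hz j] at this
    simpa [c] using this
  have hdim : dimH (torus ι) ≤ Fintype.card ι := by
    simpa using (dimH_mono hsub).trans hc.dimH_range_le
  lift d to NNReal using (Nat.cast_nonneg _).trans hd.le
  refine hausdorffMeasure_of_dimH_lt (hdim.trans_lt ?_)
  exact_mod_cast hd

variable [DecidableEq ι]

/-- The projection of `ℂ^ι` deleting the coordinate `i`. -/
def dropCoord (i : ι) : EuclideanSpace ℂ ι →L[ℂ] EuclideanSpace ℂ {j // j ≠ i} :=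
  LinearMap.toContinuousLinearMap
    { toFun := fun z => WithLp.toLp 2 fun j => z j.1
      map_add' := fun _ _ => rfl
      map_smul' := fun _ _ => rfl }

theorem dropCoord_apply (i : ι) (z : EuclideanSpace ℂ ι) (j : {j // j ≠ i}) :
    dropCoord i z j = z j := rfl

theorem dropCoord_mem_torus (i : ι) {z : EuclideanSpace ℂ ι} (hz : z ∈ torus ι) :
    dropCoord i z ∈ torus {j // j ≠ i} := fun j => hz j

theorem pEval_dropCoord (i : ι) (r : MvPolynomial {j // j ≠ i} ℂ) (z : EuclideanSpace ℂ ι) :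
    pEval r (dropCoord i z) = pEval (MvPolynomial.rename Subtype.val r) z := by
  simp only [pEval, MvPolynomial.eval_rename]
  rfl

theorem exists_mem_nhds_dist_le_mul_dist_dropCoord (g : MvPolynomial ι ℂ) (i : ι)
    {z : EuclideanSpace ℂ ι} (hz : pEval (MvPolynomial.pderiv i g) z ≠ 0) :
    ∃ u ∈ nhds z, ∃ K : NNReal, ∀ x ∈ u, ∀ y ∈ u, pEval g x = 0 → pEval g y = 0 →
      dist x y ≤ K * dist (dropCoord i x) (dropCoord i y) := by
  have hF := (hasStrictFDerivAt_pEval g z).prodMk (dropCoord i).hasStrictFDerivAt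
  obtain ⟨u, hu, K, hK⟩ := hF.exists_mem_nhds_le_mul_norm_sub <| by
    rw [injective_iff_map_eq_zero]
    intro v hv
    rw [ContinuousLinearMap.prod_apply, Prod.mk_eq_zero] at hv
    have hvj : ∀ j, j ≠ i → v j = 0 := fun j hj => by
      rw [← dropCoord_apply i v ⟨j, hj⟩, hv.2]; rfl
    have h1 := hv.1
    rw [_root_.sum_apply, Finset.sum_eq_single i (fun j _ hj => by simp [hvj j hj])
      (by simp)] at h1
    have hvi : v i = 0 := by simpa [hz] using h1
    ext j
    by_cases hj : j = i
    · rw [hj]; exact hvi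
    · exact hvj j hj
  refine ⟨u, hu, K, fun x hx y hy hgx hgy => ?_⟩
  have := hK x hx y hy
  simpa [hgx, hgy, dist_eq_norm, Prod.norm_def] using this

/-- A subset of the zero set of a nonzero polynomial is Hausdorff-null if all its coordinate
projections are. -/
theorem hausdorffMeasure_eq_zero_of_dropCoord {f : MvPolynomial ι ℂ} (hf : f ≠ 0)
    {S : Set (EuclideanSpace ℂ ι)} (hS : ∀ z ∈ S, pEval f z = 0) {d : ℝ} (hd : 0 ≤ d)
    (h : ∀ i, μH[d] (dropCoord i '' S) = 0) : μH[d] S = 0 := by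
  let D : List ι → MvPolynomial ι ℂ := fun L => L.foldl (fun g i => MvPolynomial.pderiv i g) f
  let A : List ι × ι → Set (EuclideanSpace ℂ ι) := fun t =>
    {z | z ∈ S ∧ pEval (D t.1) z = 0 ∧ pEval (MvPolynomial.pderiv t.2 (D t.1)) z ≠ 0}
  have hcover : S ⊆ ⋃ t, A t := by
    intro z hz
    by_contra hcon
    simp only [mem_iUnion, not_exists] at hcon
    obtain ⟨L, hL⟩ := MvPolynomial.exists_eval_foldl_pderiv_ne_zero (fun i => z i) hf
    refine hL ?_
    change pEval (D L) z = 0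
    clear hL
    induction L using List.reverseRecOn with
    | nil => exact hS z hz
    | append_singleton L i ih =>
      by_contra hne
      refine hcon (L, i) ⟨hz, ih, ?_⟩
      simpa [D] using hne
  refine measure_mono_null hcover (measure_iUnion_null fun t => ?_)
  refine measure_null_of_locally_null _ fun z hz => ?_
  obtain ⟨u, hu, K, hK⟩ := exists_mem_nhds_dist_le_mul_dist_dropCoord _ _ hz.2.2
  refine ⟨A t ∩ u, inter_mem_nhdsWithin _ hu, ?_⟩
  refine hausdorffMeasure_eq_zero_of_image (f := dropCoord t.2) (K := K)
    (fun x hx y hy => hK x hx.2 y hy.2 hx.1.2.1 hy.1.2.1) hd ?_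
  exact measure_mono_null (image_mono fun x hx => hx.1.1) (h t.2)

/-- The zero set of a nonzero polynomial on the torus is null for the Hausdorff measure of the
dimension of the torus. -/
theorem hausdorffMeasure_torus_zeroSet_eq_zero {f : MvPolynomial ι ℂ} (hf : f ≠ 0) :
    μH[Fintype.card ι] {z | z ∈ torus ι ∧ pEval f z = 0} = 0 := by
  classical
  refine hausdorffMeasure_eq_zero_of_dropCoord hf (fun z hz => hz.2) (Nat.cast_nonneg _) fun i => ?_
  refine measure_mono_null ((image_subset_iff (t := torus _)).2 fun z hz => dropCoord_mem_torus i hz.1)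
    (hausdorffMeasure_torus_eq_zero ?_)
  have : 0 < Fintype.card ι := Fintype.card_pos_iff.2 ⟨i⟩
  simp only [ne_eq, Fintype.card_subtype_compl, Fintype.card_unique, Nat.cast_lt]
  omega

/-- On the torus, zeros of the denominator of a rational inner function are zeros of the
numerator. -/
theorem IsRationalInner.pEval_num_eq_zero {n : ℕ} {p q : MvPolynomial (Fin n) ℂ}
    {φ : EuclideanSpace ℂ (Fin n) → ℂ} (hφ : IsRationalInner n p q φ)
    {ζ : EuclideanSpace ℂ (Fin n)} (hζ : ζ ∈ torus (Fin n)) (hq : pEval q ζ = 0) :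
    pEval p ζ = 0 := by
  have hlim : ∀ g : MvPolynomial (Fin n) ℂ, Tendsto (fun ρ : ℝ => ‖pEval g ((ρ : ℂ) • ζ)‖)
      (nhdsWithin 1 (Iio 1)) (nhds ‖pEval g ζ‖) := fun g => by
    have hc : Continuous fun ρ : ℝ => ‖pEval g ((ρ : ℂ) • ζ)‖ :=
      ((continuous_pEval g).comp (Complex.continuous_ofReal.smul continuous_const)).norm
    simpa using (hc.tendsto 1).mono_left nhdsWithin_le_nhds
  have hle : ‖pEval p ζ‖ ≤ ‖pEval q ζ‖ := by
    refine le_of_tendsto_of_tendsto (hlim p) (hlim q) ?_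
    filter_upwards [Ioo_mem_nhdsLT (zero_lt_one (α := ℝ))] with ρ hρ
    have hmem : (ρ : ℂ) • ζ ∈ polydisc n := fun j => by
      simp [hζ j, abs_of_pos hρ.1, hρ.2]
    have h1 := hφ.abs_lt_one _ hmem
    rw [hφ.phi_eq _ hmem, norm_div, div_lt_one (norm_pos_iff.2 (hφ.q_ne_zero _ hmem))] at h1
    exact h1.le
  rw [hq, norm_zero] at hle
  exact norm_le_zero_iff.1 hle

end Analysis

/-- The zero set of the denominator of a rational inner function on the unit torus is
`ℋ^{n-1}`-null. -/
theorem hausdorff_null_denominator_zero_set {n : ℕ} (p q : MvPolynomial (Fin n) ℂ)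
    (φ : EuclideanSpace ℂ (Fin n) → ℂ) (hφ : IsRationalInner n p q φ) :
    μH[(n : ℝ) - 1] {ζ | ζ ∈ torus (Fin n) ∧ pEval q ζ = 0} = 0 := by
  rcases Nat.eq_zero_or_pos n with rfl | hn
  · rw [(eq_empty_iff_forall_notMem (s := {ζ | ζ ∈ torus (Fin 0) ∧ pEval q ζ = 0})).2
      fun ζ hζ => hφ.q_ne_zero ζ (fun j => j.elim0) hζ.2, measure_empty]
  have hq : q ≠ 0 := fun h => hφ.q_ne_zero 0 (fun j => by simp) (by simp [h, pEval])
  have hn1 : (1 : ℝ) ≤ n := by exact_mod_cast hn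
  refine hausdorffMeasure_eq_zero_of_dropCoord hq (fun z hz => hz.2) (by linarith) fun i => ?_
  obtain ⟨a, b, r, hr, hab⟩ := MvPolynomial.exists_mul_add_mul_eq_rename_of_isRelPrime i
    (fun d hp hq => hφ.coprime d hp hq : IsRelPrime p q)
  have hcard : (Fintype.card {j // j ≠ i} : ℝ) = n - 1 := by
    simp [Nat.cast_sub hn]
  rw [← hcard]
  refine measure_mono_null (image_subset_iff.2 fun z hz => ?_)
    (hausdorffMeasure_torus_zeroSet_eq_zero hr)
  refine ⟨dropCoord_mem_torus i hz.1, ?_⟩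
  have hp : MvPolynomial.eval (fun j => z j) p = 0 := hφ.pEval_num_eq_zero hz.1 hz.2
  have hq : MvPolynomial.eval (fun j => z j) q = 0 := hz.2
  rw [pEval_dropCoord, ← hab]
  simp [pEval, hp, hq]

end
end

section
/- Let φ be a rational inner function on the polydisc 𝔻ⁿ. Then for every ζ ∈ 𝕋ⁿ the radial limit lim_{ρ→1⁻} φ(ρζ) exists and has modulus exactly 1. (That is, the boundary-value function φ₁ is defined at every point of 𝕋ⁿ, not merely almost everywhere, and attains unimodular values everywhere on 𝕋ⁿ.) -/
open MeasureTheory Filter Set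
open scoped ENNReal

noncomputable section

/-- Restriction of a multivariate polynomial to the complex line through `ζ`. -/
def linePoly {n : ℕ} (p : MvPolynomial (Fin n) ℂ) (ζ : EuclideanSpace ℂ (Fin n)) :
    Polynomial ℂ :=
  MvPolynomial.aeval (fun i => Polynomial.C (ζ i) * Polynomial.X) p

lemma eval_linePoly {n : ℕ} (p : MvPolynomial (Fin n) ℂ) (ζ : EuclideanSpace ℂ (Fin n))
    (w : ℂ) : (linePoly p ζ).eval w = pEval p (w • ζ) := by
  unfold linePoly pEval
  induction p using MvPolynomial.induction_on with
  | C a => simp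
  | add p q hp hq => simp [hp, hq]
  | mul_X p i hp =>
    rw [map_mul, map_mul, Polynomial.eval_mul, hp, MvPolynomial.aeval_X, MvPolynomial.eval_X]
    simp [mul_comm w]

lemma continuous_pEval_s7 {n : ℕ} (p : MvPolynomial (Fin n) ℂ) : Continuous (pEval p) :=
  (MvPolynomial.continuous_eval p).comp (by fun_prop)

/-- Two polynomials with the same modulus on the circle off `1` have the same modulus at `1`. -/
lemma norm_eval_one_eq_of_circle {P Q : Polynomial ℂ}
    (h : ∀ w : ℂ, ‖w‖ = 1 → w ≠ 1 → ‖P.eval w‖ = ‖Q.eval w‖) :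
    ‖P.eval 1‖ = ‖Q.eval 1‖ := by
  let u : ℕ → ℂ := fun k => Complex.exp (((1 / ((k : ℝ) + 1) : ℝ) : ℂ) * Complex.I)
  have hu : Tendsto u atTop (nhds 1) := by
    have h0 : Continuous fun t : ℝ => Complex.exp ((t : ℂ) * Complex.I) := by fun_prop
    simpa [u, Function.comp_def] using
      (h0.tendsto 0).comp tendsto_one_div_add_atTop_nhds_zero_nat
  have hne : ∀ k, u k ≠ 1 := by
    intro k hk
    have hpos : (0 : ℝ) < 1 / ((k : ℝ) + 1) := by positivity
    have hle : 1 / ((k : ℝ) + 1) ≤ 1 := by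
      rw [div_le_one (by positivity)]
      linarith [(Nat.cast_nonneg k : (0 : ℝ) ≤ k)]
    have him := congrArg Complex.im hk
    rw [Complex.exp_ofReal_mul_I_im, Complex.one_im] at him
    exact (Real.sin_pos_of_pos_of_lt_pi hpos (by linarith [Real.pi_gt_three])).ne' him
  have hP := ((P.continuous.tendsto 1).comp hu).norm
  have hQ := ((Q.continuous.tendsto 1).comp hu).norm
  refine tendsto_nhds_unique hP (hQ.congr fun k => ?_)
  exact (h _ (Complex.norm_exp_ofReal_mul_I _) (hne k)).symm

/-- A rational function of one variable that is unimodular on the circle has a unimodular limit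
at `1`, even if its numerator and denominator vanish there. -/
lemma exists_tendsto_div_of_circle {P Q : Polynomial ℂ} (hQ : Q ≠ 0)
    (h : ∀ w : ℂ, ‖w‖ = 1 → w ≠ 1 → ‖P.eval w‖ = ‖Q.eval w‖) :
    ∃ β : ℂ, ‖β‖ = 1 ∧
      Tendsto (fun w => P.eval w / Q.eval w) (nhdsWithin 1 {1}ᶜ) (nhds β) := by
  induction hd : Q.natDegree generalizing P Q with
  | zero =>
    have h1 := norm_eval_one_eq_of_circle h
    have hQ1 : Q.eval 1 ≠ 0 := by
      rw [Polynomial.eq_C_of_natDegree_eq_zero hd] at hQ ⊢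
      simpa using hQ
    refine ⟨P.eval 1 / Q.eval 1, ?_, ?_⟩
    · rw [norm_div, h1, div_self (norm_ne_zero_iff.2 hQ1)]
    · exact ((P.continuous.tendsto 1).div (Q.continuous.tendsto 1) hQ1).mono_left
        nhdsWithin_le_nhds
  | succ d ih =>
    have h1 := norm_eval_one_eq_of_circle h
    by_cases hQ1 : Q.eval 1 = 0
    · have hP1 : P.eval 1 = 0 := by simpa [hQ1] using h1
      obtain ⟨P', rfl⟩ := Polynomial.dvd_iff_isRoot.2 hP1
      obtain ⟨Q', rfl⟩ := Polynomial.dvd_iff_isRoot.2 hQ1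
      have hQ' : Q' ≠ 0 := right_ne_zero_of_mul hQ
      have hd' : Q'.natDegree = d := by
        rw [Polynomial.natDegree_mul (Polynomial.X_sub_C_ne_zero 1) hQ',
          Polynomial.natDegree_X_sub_C] at hd
        omega
      obtain ⟨β, hβ, hlim⟩ := ih (P := P') hQ' (fun w hw hw1 => by
        have := h w hw hw1
        simpa [sub_eq_zero, hw1] using this) hd'
      refine ⟨β, hβ, hlim.congr' ?_⟩
      filter_upwards [self_mem_nhdsWithin] with w hw
      have hw1 : w - 1 ≠ 0 := sub_ne_zero.2 hw
      simp [mul_div_mul_left _ _ hw1]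
    · refine ⟨P.eval 1 / Q.eval 1, ?_, ?_⟩
      · rw [norm_div, h1, div_self (norm_ne_zero_iff.2 hQ1)]
      · exact ((P.continuous.tendsto 1).div (Q.continuous.tendsto 1) hQ1).mono_left
          nhdsWithin_le_nhds

/-- A property that is open near a point of the torus and holds at that point, holds at some
point of the torus outside any given `ℋⁿ`-null set. -/
lemma exists_mem_torus_diff_of_null {n : ℕ} {E U : Set (EuclideanSpace ℂ (Fin n))}
    (hE : μH[(n : ℝ)] E = 0) (hU : IsOpen U) {ζ : EuclideanSpace ℂ (Fin n)}
    (hζ : ζ ∈ torus (Fin n)) (hζU : ζ ∈ U) : ∃ z ∈ U, z ∈ torus (Fin n) \ E := by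
  by_contra! hcon
  let F : EuclideanSpace ℂ (Fin n) → Fin n → ℝ := fun z j => (z j * starRingEnd ℂ (ζ j)).im
  let G : (Fin n → ℝ) → EuclideanSpace ℂ (Fin n) := fun x =>
    WithLp.toLp 2 fun j => ((√(1 - x j ^ 2) : ℝ) + (x j : ℝ) * Complex.I) * ζ j
  have hG : Continuous G := by
    refine (PiLp.continuous_toLp 2 _).comp (continuous_pi fun j => ?_)
    fun_prop
  have hG0 : G 0 = ζ := by
    ext j
    simp [G]
  have hFG : ∀ x, F (G x) = x := by
    intro x
    ext j
    have : ζ j * starRingEnd ℂ (ζ j) = 1 := by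
      rw [Complex.mul_conj, Complex.normSq_eq_norm_sq, hζ j]
      simp
    simp only [F, G, mul_assoc, this]
    simp
  have hF : LipschitzWith 1 F := by
    refine LipschitzWith.of_dist_le_mul fun z w => ?_
    rw [NNReal.coe_one, one_mul, dist_pi_le_iff dist_nonneg]
    intro j
    rw [Real.dist_eq, ← Complex.sub_im, ← sub_mul]
    refine (Complex.abs_im_le_norm _).trans ?_
    rw [norm_mul, RCLike.norm_conj, hζ j, mul_one, dist_eq_norm]
    exact PiLp.norm_apply_le (z - w) j
  let V : Set (Fin n → ℝ) := G ⁻¹' U ∩ Metric.ball 0 1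
  have hV : IsOpen V := (hU.preimage hG).inter Metric.isOpen_ball
  have hVne : V.Nonempty := ⟨0, by simpa [hG0] using hζU, by simp⟩
  have hVE : V ⊆ F '' E := by
    rintro x ⟨hxU, hx⟩
    refine ⟨G x, ?_, hFG x⟩
    by_contra hxE
    refine hcon _ hxU ⟨fun j => ?_, hxE⟩
    have hxj : |x j| < 1 := by
      simpa using (norm_le_pi_norm x j).trans_lt (by simpa using hx)
    have hnonneg : 0 ≤ 1 - x j ^ 2 := by
      have := (sq_lt_one_iff_abs_lt_one (x j)).2 hxj
      linarith
    simp only [G, norm_mul, hζ j, mul_one]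
    rw [Complex.norm_add_mul_I, Real.sq_sqrt hnonneg]
    simp
  have hnull : μH[(n : ℝ)] (F '' E) = 0 := by
    have := hF.hausdorffMeasure_image_le (Nat.cast_nonneg n) E
    simpa [hE] using this
  have hvol : (volume : Measure (Fin n → ℝ)) V = 0 := by
    rw [← hausdorffMeasure_pi_real, Fintype.card_fin]
    exact measure_mono_null hVE hnull
  exact (hV.measure_pos volume hVne).ne' hvol

/-- The radial segment towards a point of the torus lies in the polydisc. -/
lemma eventually_smul_mem_polydisc {n : ℕ} {ζ : EuclideanSpace ℂ (Fin n)}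
    (hζ : ζ ∈ torus (Fin n)) :
    ∀ᶠ ρ : ℝ in nhdsWithin 1 (Set.Iio 1), (ρ : ℂ) • ζ ∈ polydisc n := by
  filter_upwards [Ioo_mem_nhdsLT (zero_lt_one' ℝ)] with ρ hρ j
  simpa [hζ j, abs_of_pos hρ.1] using hρ.2

namespace IsRationalInner

variable {n : ℕ} {p q : MvPolynomial (Fin n) ℂ} {φ : EuclideanSpace ℂ (Fin n) → ℂ}

/-- The numerator and denominator of a rational inner function have the same modulus wherever
the radial limit is unimodular. -/
lemma norm_eq_of_hasRadialLimit (hφ : IsRationalInner n p q φ)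
    {ζ : EuclideanSpace ℂ (Fin n)} (hζ : ζ ∈ torus (Fin n)) {β : ℂ} (hβ : ‖β‖ = 1)
    (h : HasRadialLimit φ ζ β) : ‖pEval p ζ‖ = ‖pEval q ζ‖ := by
  have hlim : ∀ r : MvPolynomial (Fin n) ℂ, Tendsto (fun ρ : ℝ => pEval r ((ρ : ℂ) • ζ))
      (nhdsWithin 1 (Set.Iio 1)) (nhds (pEval r ζ)) := by
    intro r
    have hc : Continuous fun ρ : ℝ => pEval r ((ρ : ℂ) • ζ) :=
      (continuous_pEval_s7 r).comp (by fun_prop)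
    simpa using (hc.tendsto 1).mono_left nhdsWithin_le_nhds
  have hmul : Tendsto (fun ρ : ℝ => pEval p ((ρ : ℂ) • ζ)) (nhdsWithin 1 (Set.Iio 1))
      (nhds (β * pEval q ζ)) := by
    refine (Tendsto.mul h (hlim q)).congr' ?_
    filter_upwards [eventually_smul_mem_polydisc hζ] with ρ hρ
    rw [hφ.phi_eq _ hρ, div_mul_cancel₀ _ (hφ.q_ne_zero _ hρ)]
  rw [tendsto_nhds_unique (hlim p) hmul, norm_mul, hβ, one_mul]

lemma norm_eq_on_torus (hφ : IsRationalInner n p q φ)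
    {ζ : EuclideanSpace ℂ (Fin n)} (hζ : ζ ∈ torus (Fin n)) :
    ‖pEval p ζ‖ = ‖pEval q ζ‖ := by
  obtain ⟨E, -, hE, hlim⟩ := hφ.inner
  by_contra hne
  obtain ⟨z, hzU, hz⟩ := exists_mem_torus_diff_of_null hE
    (isOpen_ne_fun (continuous_pEval_s7 p).norm (continuous_pEval_s7 q).norm) hζ hne
  obtain ⟨β, hβ, hr⟩ := hlim z hz
  exact hzU (hφ.norm_eq_of_hasRadialLimit hz.1 hβ hr)

end IsRationalInner

/-- The boundary-value function of a rational inner function on the polydisc is defined at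
every point of the torus and is unimodular there. -/
theorem radial_limit_everywhere {n : ℕ} (p q : MvPolynomial (Fin n) ℂ)
    (φ : EuclideanSpace ℂ (Fin n) → ℂ) (hφ : IsRationalInner n p q φ) :
    ∀ ζ ∈ torus (Fin n), ∃ β : ℂ, ‖β‖ = 1 ∧ HasRadialLimit φ ζ β := by
  intro ζ hζ
  have hQ : linePoly q ζ ≠ 0 := by
    intro h0
    refine hφ.q_ne_zero 0 (fun j => by simp) ?_
    simpa [h0] using (eval_linePoly q ζ 0).symm
  obtain ⟨β, hβ, hlim⟩ := exists_tendsto_div_of_circle (P := linePoly p ζ) hQ (by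
    intro w hw _
    rw [eval_linePoly, eval_linePoly]
    exact hφ.norm_eq_on_torus fun j => by simp [hw, hζ j])
  refine ⟨β, hβ, ?_⟩
  have hρ : Tendsto (fun ρ : ℝ => (ρ : ℂ)) (nhdsWithin 1 (Set.Iio 1)) (nhdsWithin 1 {1}ᶜ) := by
    refine tendsto_nhdsWithin_iff.2 ⟨?_, ?_⟩
    · simpa using (Complex.continuous_ofReal.tendsto 1).mono_left nhdsWithin_le_nhds
    · filter_upwards [self_mem_nhdsWithin] with ρ hρ
      simpa using (show ρ < 1 from hρ).ne
  refine (hlim.comp hρ).congr' ?_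
  filter_upwards [eventually_smul_mem_polydisc hζ] with ρ hρ
  simp only [Function.comp_apply]
  rw [hφ.phi_eq _ hρ, eval_linePoly, eval_linePoly]

end
end
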